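/- arXiv:1607.08524 — 4 statements merged into one kernel-verified Lean document; each statement's English description precedes it below -/
import Mathlib

section
/- The trigonometric six-vertex R-matrix satisfies the Yang–Baxter equation: for all x₁, x₂, x₃ ∈ ℂ, R_{12}(x₁−x₂) R_{13}(x₁−x₃) R_{23}(x₂−x₃) = R_{23}(x₂−x₃) R_{13}(x₁−x₃) R_{12}(x₁−x₂) as operators on ℂ²⊗ℂ²⊗ℂ². -/
noncomputable section

open Matrix BigOperators

/-- `a(x) = sinh(x+γ)` -/
def af (γ x : ℂ) : ℂ := Complex.sinh (x + γ)
/-- `b(x) = sinh(x)` -/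
def bf (x : ℂ) : ℂ := Complex.sinh x
/-- `c(x) = sinh(γ)` -/
def cf (γ : ℂ) (_x : ℂ) : ℂ := Complex.sinh γ

/-- The trigonometric six-vertex R-matrix on `ℂ² ⊗ ℂ²`, in the ordered basis
`e₁⊗e₁, e₁⊗e₂, e₂⊗e₁, e₂⊗e₂` given by rows `[a,0,0,0],[0,b,c,0],[0,c,b,0],[0,0,0,a]`. -/
def Rmat (γ x : ℂ) : Matrix (Fin 2 × Fin 2) (Fin 2 × Fin 2) ℂ := fun p q =>
  if p = q then (if p.1 = p.2 then af γ x else bf x)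
  else if p.1 = q.2 ∧ p.2 = q.1 ∧ p.1 ≠ p.2 then cf γ x else 0

/-- `R₁₂(x)` acting on factors 1, 2 of `ℂ²⊗ℂ²⊗ℂ²`. -/
def R12 (γ x : ℂ) : Matrix (Fin 2 × Fin 2 × Fin 2) (Fin 2 × Fin 2 × Fin 2) ℂ := fun p q =>
  Rmat γ x (p.1, p.2.1) (q.1, q.2.1) * (if p.2.2 = q.2.2 then 1 else 0)

/-- `R₁₃(x)` acting on factors 1, 3 of `ℂ²⊗ℂ²⊗ℂ²`. -/
def R13 (γ x : ℂ) : Matrix (Fin 2 × Fin 2 × Fin 2) (Fin 2 × Fin 2 × Fin 2) ℂ := fun p q =>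
  Rmat γ x (p.1, p.2.2) (q.1, q.2.2) * (if p.2.1 = q.2.1 then 1 else 0)

/-- `R₂₃(x)` acting on factors 2, 3 of `ℂ²⊗ℂ²⊗ℂ²`. -/
def R23 (γ x : ℂ) : Matrix (Fin 2 × Fin 2 × Fin 2) (Fin 2 × Fin 2 × Fin 2) ℂ := fun p q =>
  Rmat γ x (p.2.1, p.2.2) (q.2.1, q.2.2) * (if p.1 = q.1 then 1 else 0)

/-- The addition formula behind the Yang–Baxter equation in the one-magnon sector. -/
theorem af_mul_af (γ u v : ℂ) :
    af γ u * af γ v = bf u * bf v + cf γ 0 * af γ (u + v) := by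
  simp only [af, bf, cf, Complex.sinh_add, Complex.cosh_add]
  linear_combination (Complex.sinh u * Complex.sinh v) * Complex.cosh_sq_sub_sinh_sq γ

/-- The addition formula moving the shift by `γ` between the weights `a` and `b`. -/
theorem af_mul_bf_add (γ u v : ℂ) :
    af γ u * bf (u + v) = bf u * af γ (u + v) + cf γ 0 * bf v := by
  simp only [af, bf, cf, Complex.sinh_add, Complex.cosh_add]
  linear_combination (Complex.sinh γ * Complex.sinh v) * Complex.cosh_sq_sub_sinh_sq u

/-- The six-vertex R-matrix satisfies the Yang–Baxter equation. -/
theorem six_vertex_yang_baxter (γ x₁ x₂ x₃ : ℂ) :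
    R12 γ (x₁ - x₂) * R13 γ (x₁ - x₃) * R23 γ (x₂ - x₃) =
      R23 γ (x₂ - x₃) * R13 γ (x₁ - x₃) * R12 γ (x₁ - x₂) := by
  obtain ⟨u, hu⟩ : ∃ u, u = x₁ - x₂ := ⟨_, rfl⟩
  obtain ⟨v, hv⟩ : ∃ v, v = x₂ - x₃ := ⟨_, rfl⟩
  have huv : x₁ - x₃ = u + v := by rw [hu, hv]; ring
  rw [huv, ← hu, ← hv]
  have haa := af_mul_af γ u v
  have hab := af_mul_bf_add γ u v
  have hba := af_mul_bf_add γ v u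
  rw [add_comm v u] at hba
  ext ⟨i, j, k⟩ ⟨i', j', k'⟩
  simp only [Matrix.mul_apply, Fintype.sum_prod_type, Fin.sum_univ_two, R12, R13, R23, Rmat]
  unfold cf at *
  fin_cases i <;> fin_cases j <;> fin_cases k <;> fin_cases i' <;> fin_cases j' <;>
    fin_cases k' <;> simp <;> grind
end
end

section
/- The diagonal matrix K(x) = diag(sinh(h+x), sinh(h−x)) satisfies the reflection equation: for all x₁, x₂ ∈ ℂ, R_{12}(x₁−x₂) K₁(x₁) R_{12}(x₁+x₂) K₂(x₂) = K₂(x₂) R_{12}(x₁+x₂) K₁(x₁) R_{12}(x₁−x₂) as operators on ℂ²⊗ℂ², where K₁(x) = K(x)⊗id and K₂(x) = id⊗K(x). -/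
noncomputable section

open Matrix BigOperators Kronecker

/-- The diagonal reflection matrix `K(x) = diag(sinh(h+x), sinh(h−x))`. -/
def Kd (h x : ℂ) : Matrix (Fin 2) (Fin 2) ℂ :=
  !![Complex.sinh (h + x), 0; 0, Complex.sinh (h - x)]

/-- The scalar identity to which the reflection equation reduces in the zero-weight block. -/
theorem sinh_reflection_identity (h x y : ℂ) :
    Complex.sinh (x - y) * Complex.sinh (h + x) * Complex.sinh (h + y) +
        Complex.sinh (x + y) * Complex.sinh (h - x) * Complex.sinh (h + y) =
      Complex.sinh (x + y) * Complex.sinh (h + x) * Complex.sinh (h - y) +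
        Complex.sinh (x - y) * Complex.sinh (h - x) * Complex.sinh (h - y) := by
  simp only [Complex.sinh_add, Complex.sinh_sub]
  ring

/-- `K(x)` satisfies the reflection equation
`R₁₂(x₁−x₂) K₁(x₁) R₁₂(x₁+x₂) K₂(x₂) = K₂(x₂) R₁₂(x₁+x₂) K₁(x₁) R₁₂(x₁−x₂)`. -/
theorem reflection_equation (γ h x₁ x₂ : ℂ) :
    Rmat γ (x₁ - x₂) * (Kd h x₁ ⊗ₖ (1 : Matrix (Fin 2) (Fin 2) ℂ)) *
        Rmat γ (x₁ + x₂) * ((1 : Matrix (Fin 2) (Fin 2) ℂ) ⊗ₖ Kd h x₂) =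
      ((1 : Matrix (Fin 2) (Fin 2) ℂ) ⊗ₖ Kd h x₂) * Rmat γ (x₁ + x₂) *
        (Kd h x₁ ⊗ₖ (1 : Matrix (Fin 2) (Fin 2) ℂ)) * Rmat γ (x₁ - x₂) := by
  have key := sinh_reflection_identity h x₁ x₂
  ext ⟨i, j⟩ ⟨k, l⟩
  fin_cases i <;> fin_cases j <;> fin_cases k <;> fin_cases l <;>
    simp [Matrix.mul_apply, Fintype.sum_prod_type, Fin.sum_univ_two, Rmat, Kd, af, bf, cf,
      Matrix.one_apply] <;>
    first
      | ring1
      | linear_combination Complex.sinh γ * key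
      | linear_combination -Complex.sinh γ * key
end
end

section
/- The diagonal matrix K̄(x) = diag(sinh(h̄−x−γ), sinh(h̄+x+γ)) satisfies the dual reflection equation: for all x₁, x₂ ∈ ℂ, R_{12}(−x₁+x₂) K̄₁^{t₁}(x₁) R_{12}(−x₁−x₂−2γ) K̄₂^{t₂}(x₂) = K̄₂^{t₂}(x₂) R_{12}(−x₁−x₂−2γ) K̄₁^{t₁}(x₁) R_{12}(−x₁+x₂) as operators on ℂ²⊗ℂ², where t_i denotes partial transposition in the i-th tensor factor, K̄₁(x) = K̄(x)⊗id and K̄₂(x) = id⊗K̄(x). -/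
noncomputable section

open Matrix BigOperators Kronecker

/-- The dual diagonal reflection matrix `K̄(x) = diag(sinh(h̄−x−γ), sinh(h̄+x+γ))`. -/
def Kbar (γ hb x : ℂ) : Matrix (Fin 2) (Fin 2) ℂ :=
  !![Complex.sinh (hb - x - γ), 0; 0, Complex.sinh (hb + x + γ)]

/-- Partial transposition in the first tensor factor of `ℂ² ⊗ ℂ²`. -/
def pt1 (M : Matrix (Fin 2 × Fin 2) (Fin 2 × Fin 2) ℂ) :
    Matrix (Fin 2 × Fin 2) (Fin 2 × Fin 2) ℂ := fun p q => M (q.1, p.2) (p.1, q.2)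

/-- Partial transposition in the second tensor factor of `ℂ² ⊗ ℂ²`. -/
def pt2 (M : Matrix (Fin 2 × Fin 2) (Fin 2 × Fin 2) ℂ) :
    Matrix (Fin 2 × Fin 2) (Fin 2 × Fin 2) ℂ := fun p q => M (p.1, q.2) (q.1, p.2)

/-- The scalar identity behind the reflection equation of a diagonal reflection matrix. -/
lemma sinh_diagonal_reflection_identity (h y z : ℂ) :
    Complex.sinh (z - y) * (Complex.sinh (h - y) * Complex.sinh (h - z) -
        Complex.sinh (h + y) * Complex.sinh (h + z)) =
      Complex.sinh (-(y + z)) * (Complex.sinh (h - y) * Complex.sinh (h + z) -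
        Complex.sinh (h + y) * Complex.sinh (h - z)) := by
  simp only [Complex.sinh_neg, Complex.sinh_add, Complex.sinh_sub]
  ring

/-- `K̄(x)` satisfies the dual reflection equation. -/
theorem dual_reflection_equation (γ hb x₁ x₂ : ℂ) :
    Rmat γ (-x₁ + x₂) * pt1 (Kbar γ hb x₁ ⊗ₖ (1 : Matrix (Fin 2) (Fin 2) ℂ)) *
        Rmat γ (-x₁ - x₂ - 2 * γ) * pt2 ((1 : Matrix (Fin 2) (Fin 2) ℂ) ⊗ₖ Kbar γ hb x₂) =
      pt2 ((1 : Matrix (Fin 2) (Fin 2) ℂ) ⊗ₖ Kbar γ hb x₂) * Rmat γ (-x₁ - x₂ - 2 * γ) *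
        pt1 (Kbar γ hb x₁ ⊗ₖ (1 : Matrix (Fin 2) (Fin 2) ℂ)) * Rmat γ (-x₁ + x₂) := by
  have key := sinh_diagonal_reflection_identity hb (x₁ + γ) (x₂ + γ)
  rw [show x₂ + γ - (x₁ + γ) = -x₁ + x₂ by ring,
    show -(x₁ + γ + (x₂ + γ)) = -x₁ - x₂ - 2 * γ by ring,
    ← sub_sub, ← sub_sub, ← add_assoc, ← add_assoc] at key
  ext ⟨i, j⟩ ⟨k, l⟩
  fin_cases i <;> fin_cases j <;> fin_cases k <;> fin_cases l <;>
    simp [Matrix.mul_apply, Fintype.sum_prod_type, Rmat, pt1, pt2, Kbar, af, bf, cf,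
      Matrix.kroneckerMap_apply] <;>
    first
    | ring1
    | linear_combination Complex.sinh γ * key
    | linear_combination -Complex.sinh γ * key
end
end

section
/- The off-shell scalar product of the open six-vertex chain is a symmetric function of each group of its variables: for all n ≤ L, all x₁,…,x_n, y₁,…,y_n ∈ ℂ, and all permutations σ, τ of {1,…,n}, one has 𝒮̃_n(x_{σ(1)},…,x_{σ(n)} | y_{τ(1)},…,y_{τ(n)}) = 𝒮̃_n(x₁,…,x_n | y₁,…,y_n). -/
noncomputable section

open Matrix BigOperators

/-- `R_{0j}(x)` acting on the auxiliary factor and the `j`-th quantum factor of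
`ℂ² ⊗ (ℂ²)^{⊗L}`, identity elsewhere. -/
def Raux (γ : ℂ) {L : ℕ} (x : ℂ) (j : Fin L) :
    Matrix (Fin 2 × (Fin L → Fin 2)) (Fin 2 × (Fin L → Fin 2)) ℂ := fun p q =>
  Rmat γ x (p.1, p.2 j) (q.1, q.2 j) * (if ∀ k, k ≠ j → p.2 k = q.2 k then 1 else 0)

/-- `K₀(x)`: the reflection matrix acting on the auxiliary factor of `ℂ² ⊗ (ℂ²)^{⊗L}`. -/
def K0lift (h : ℂ) {L : ℕ} (x : ℂ) :
    Matrix (Fin 2 × (Fin L → Fin 2)) (Fin 2 × (Fin L → Fin 2)) ℂ := fun p q =>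
  Kd h x p.1 q.1 * (if p.2 = q.2 then 1 else 0)

/-- `K̄₀(x)`: the dual reflection matrix acting on the auxiliary factor. -/
def Kbar0lift (γ hb : ℂ) {L : ℕ} (x : ℂ) :
    Matrix (Fin 2 × (Fin L → Fin 2)) (Fin 2 × (Fin L → Fin 2)) ℂ := fun p q =>
  Kbar γ hb x p.1 q.1 * (if p.2 = q.2 then 1 else 0)

/-- The double-row monodromy matrix
`T̃₀(x) = K̄₀(x) R_{0L}(x−μ_L)⋯R_{01}(x−μ₁) K₀(x) R_{01}(x+μ₁)⋯R_{0L}(x+μ_L)`. -/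
def Topen (γ h hb : ℂ) {L : ℕ} (μ : Fin L → ℂ) (x : ℂ) :
    Matrix (Fin 2 × (Fin L → Fin 2)) (Fin 2 × (Fin L → Fin 2)) ℂ :=
  Kbar0lift γ hb x * ((List.ofFn fun j => Raux γ (x - μ j) j).reverse).prod *
    K0lift h x * (List.ofFn fun j => Raux γ (x + μ j) j).prod

/-- The block `Ã(x)` of the double-row monodromy matrix. -/
def AmatO (γ h hb : ℂ) {L : ℕ} (μ : Fin L → ℂ) (x : ℂ) :
    Matrix (Fin L → Fin 2) (Fin L → Fin 2) ℂ := fun f g => Topen γ h hb μ x (0, f) (0, g)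

/-- The block `B̃(x)` of the double-row monodromy matrix. -/
def BmatO (γ h hb : ℂ) {L : ℕ} (μ : Fin L → ℂ) (x : ℂ) :
    Matrix (Fin L → Fin 2) (Fin L → Fin 2) ℂ := fun f g => Topen γ h hb μ x (0, f) (1, g)

/-- The block `C̃(x)` of the double-row monodromy matrix. -/
def CmatO (γ h hb : ℂ) {L : ℕ} (μ : Fin L → ℂ) (x : ℂ) :
    Matrix (Fin L → Fin 2) (Fin L → Fin 2) ℂ := fun f g => Topen γ h hb μ x (1, f) (0, g)

/-- The block `D̃(x)` of the double-row monodromy matrix. -/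
def DmatO (γ h hb : ℂ) {L : ℕ} (μ : Fin L → ℂ) (x : ℂ) :
    Matrix (Fin L → Fin 2) (Fin L → Fin 2) ℂ := fun f g => Topen γ h hb μ x (1, f) (1, g)

/-- The index of the pseudo-vacuum `|0⟩ = e₁^{⊗L}` in the standard basis. -/
def vacIdx (L : ℕ) : Fin L → Fin 2 := fun _ => 0

/-- The off-shell scalar product of the open chain
`𝒮̃_n(x₁,…,x_n | y₁,…,y_n) = ⟨0| C̃(x₁)⋯C̃(x_n) B̃(y₁)⋯B̃(y_n) |0⟩`. -/
def SoffO (γ h hb : ℂ) {L : ℕ} (μ : Fin L → ℂ) {n : ℕ} (x y : Fin n → ℂ) : ℂ :=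
  ((List.ofFn fun i => CmatO γ h hb μ (x i)).prod *
    (List.ofFn fun i => BmatO γ h hb μ (y i)).prod) (vacIdx L) (vacIdx L)

namespace OpenSixVertex

section Embeddings

variable {B C : Type*} [Ring B] [Ring C]

/-- A `2 × 2` operator acting on the first of two auxiliary factors. -/
def auxLeft : Matrix (Fin 2) (Fin 2) B →+* Matrix (Fin 2 × Fin 2) (Fin 2 × Fin 2) B :=
  (blockDiagonalRingHom (Fin 2) (Fin 2) B).comp (Pi.constRingHom _ _)

/-- A `2 × 2` operator acting on the second of two auxiliary factors. -/
def auxRight : Matrix (Fin 2) (Fin 2) B →+* Matrix (Fin 2 × Fin 2) (Fin 2 × Fin 2) B :=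
  (reindexAlgEquiv ℤ B (Equiv.prodComm (Fin 2) (Fin 2))).toAlgHom.toRingHom.comp auxLeft

theorem auxLeft_apply (X : Matrix (Fin 2) (Fin 2) B) (p q : Fin 2 × Fin 2) :
    auxLeft X p q = if p.2 = q.2 then X p.1 q.1 else 0 := rfl

theorem auxRight_apply (X : Matrix (Fin 2) (Fin 2) B) (p q : Fin 2 × Fin 2) :
    auxRight X p q = if p.1 = q.1 then X p.2 q.2 else 0 := rfl

theorem auxLeft_mapMatrix (φ : B →+* C) (X : Matrix (Fin 2) (Fin 2) B) :
    auxLeft (φ.mapMatrix X) = φ.mapMatrix (auxLeft X) := by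
  ext p q
  simp [auxLeft_apply, apply_ite φ]

theorem auxRight_mapMatrix (φ : B →+* C) (X : Matrix (Fin 2) (Fin 2) B) :
    auxRight (φ.mapMatrix X) = φ.mapMatrix (auxRight X) := by
  ext p q
  simp [auxRight_apply, apply_ite φ]

theorem commute_auxLeft_auxRight {X Y : Matrix (Fin 2) (Fin 2) B}
    (hXY : ∀ i j k l, Commute (X i j) (Y k l)) : Commute (auxLeft X) (auxRight Y) := by
  ext ⟨i, k⟩ ⟨j, l⟩
  simp only [mul_apply, Fintype.sum_prod_type, auxLeft_apply, auxRight_apply]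
  simpa using (hXY i j k l).eq

theorem commute_auxLeft_algebraMap [Algebra ℂ B] (K : Matrix (Fin 2) (Fin 2) ℂ)
    (X : Matrix (Fin 2) (Fin 2) B) :
    Commute (auxLeft ((algebraMap ℂ B).mapMatrix K)) (auxRight X) := by
  refine commute_auxLeft_auxRight fun i j k l => ?_
  rw [RingHom.mapMatrix_apply, map_apply]
  exact Algebra.commute_algebraMap_left _ _

theorem commute_auxRight_algebraMap [Algebra ℂ B] (K : Matrix (Fin 2) (Fin 2) ℂ)
    (X : Matrix (Fin 2) (Fin 2) B) :
    Commute (auxRight ((algebraMap ℂ B).mapMatrix K)) (auxLeft X) := by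
  refine (commute_auxLeft_auxRight fun i j k l => ?_).symm
  rw [RingHom.mapMatrix_apply, map_apply]
  exact Algebra.commute_algebraMap_right _ _

end Embeddings

section LocalRelations

/-- The R-matrix read as a matrix over the first factor with entries acting on the second. -/
def lax (γ u : ℂ) : Matrix (Fin 2) (Fin 2) (Matrix (Fin 2) (Fin 2) ℂ) :=
  fun i j => fun s t => Rmat γ u (i, s) (j, t)

/-- The R-matrix acting on the two auxiliary factors, with scalar entries in an algebra. -/
def auxR (B : Type*) [Ring B] [Algebra ℂ B] (γ u : ℂ) :
    Matrix (Fin 2 × Fin 2) (Fin 2 × Fin 2) B :=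
  (algebraMap ℂ B).mapMatrix (Rmat γ u)

theorem sinh_add_mul_sinh_add (γ u v : ℂ) :
    Complex.sinh (u + γ) * Complex.sinh (v + γ) =
      Complex.sinh u * Complex.sinh v + Complex.sinh γ * Complex.sinh (u + v + γ) := by
  simp only [Complex.sinh_add, Complex.cosh_add]
  linear_combination (Complex.sinh u * Complex.sinh v) * Complex.cosh_sq γ

theorem sinh_mul_sinh_add_add (γ u v : ℂ) :
    Complex.sinh u * Complex.sinh (u + v + γ) =
      Complex.sinh (u + γ) * Complex.sinh (u + v) - Complex.sinh γ * Complex.sinh v := by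
  simp only [Complex.sinh_add, Complex.cosh_add]
  linear_combination (-Complex.sinh γ * Complex.sinh v) * Complex.cosh_sq u

set_option maxHeartbeats 4000000 in
/-- The Yang–Baxter equation, with one quantum factor in the last position. -/
theorem auxR_mul_lax_mul_lax (γ : ℂ) {u v w : ℂ} (hw : w = u + v) :
    auxR _ γ u * auxLeft (lax γ w) * auxRight (lax γ v) =
      auxRight (lax γ v) * auxLeft (lax γ w) * auxR _ γ u := by
  subst hw
  have h1 := sinh_add_mul_sinh_add γ u v
  have h2 := sinh_mul_sinh_add_add γ u v
  have h3 := sinh_mul_sinh_add_add γ v u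
  rw [add_comm v u] at h3
  ext ⟨i, k⟩ ⟨j, l⟩ s t
  fin_cases i <;> fin_cases k <;> fin_cases j <;> fin_cases l <;> fin_cases s <;> fin_cases t <;>
  simp [mul_apply, Fintype.sum_prod_type, auxLeft_apply, auxRight_apply, auxR, lax, Rmat, af, bf,
    cf, algebraMap_matrix_apply, Matrix.sum_apply, -mul_eq_mul_left_iff, -mul_eq_mul_right_iff] <;>
  grind

set_option maxHeartbeats 4000000 in
/-- The Yang–Baxter equation, with one quantum factor in the middle position. -/
theorem lax_mul_auxR_mul_lax (γ : ℂ) {u v w : ℂ} (hw : w = u + v) :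
    auxLeft (lax γ u) * auxR _ γ w * auxRight (lax γ v) =
      auxRight (lax γ v) * auxR _ γ w * auxLeft (lax γ u) := by
  subst hw
  have h1 := sinh_add_mul_sinh_add γ u v
  have h2 := sinh_mul_sinh_add_add γ u v
  have h3 := sinh_mul_sinh_add_add γ v u
  rw [add_comm v u] at h3
  ext ⟨i, k⟩ ⟨j, l⟩ s t
  fin_cases i <;> fin_cases k <;> fin_cases j <;> fin_cases l <;> fin_cases s <;> fin_cases t <;>
  simp [mul_apply, Fintype.sum_prod_type, auxLeft_apply, auxRight_apply, auxR, lax, Rmat, af, bf,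
    cf, algebraMap_matrix_apply, Matrix.sum_apply, -mul_eq_mul_left_iff, -mul_eq_mul_right_iff] <;>
  grind

/-- The diagonal matrices `K` solve the reflection equation. -/
theorem reflection_equation_Kd (γ h x y : ℂ) :
    Rmat γ (x - y) * auxLeft (Kd h x) * Rmat γ (x + y) * auxRight (Kd h y) =
      auxRight (Kd h y) * Rmat γ (x + y) * auxLeft (Kd h x) * Rmat γ (x - y) := by
  have key : Complex.sinh (x - y) * Complex.sinh (h + x) * Complex.sinh (h + y) +
      Complex.sinh (x + y) * Complex.sinh (h - x) * Complex.sinh (h + y) =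
      Complex.sinh (x + y) * Complex.sinh (h + x) * Complex.sinh (h - y) +
      Complex.sinh (x - y) * Complex.sinh (h - x) * Complex.sinh (h - y) := by
    simp only [Complex.sinh_add, Complex.sinh_sub]
    grind [Complex.cosh_sq]
  ext ⟨i, k⟩ ⟨j, l⟩
  fin_cases i <;> fin_cases k <;> fin_cases j <;> fin_cases l <;>
  simp [mul_apply, Fintype.sum_prod_type, auxLeft_apply, auxRight_apply, Rmat, af, bf, Kd,
    cf, -mul_eq_mul_left_iff, -mul_eq_mul_right_iff] <;>
  grind

end LocalRelations

/-- One step of Sklyanin's dressing, iterated along a list of sites: a solution `k₁, k₂` of the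
reflection equation, dressed by mutually commuting solutions of the exchange relations, is again
a solution. -/
theorem reflection_equation_dressed {M ι : Type*} [Monoid M] (s t k₁ k₂ : M)
    (p p' q q' : ι → M)
    (hk : s * k₁ * t * k₂ = k₂ * t * k₁ * s)
    (hspq : ∀ i, s * p i * q i = q i * p i * s)
    (hspq' : ∀ i, s * p' i * q' i = q' i * p' i * s)
    (hptq : ∀ i, p' i * t * q i = q i * t * p' i)
    (hptq' : ∀ i, p i * t * q' i = q' i * t * p i)
    (hkq : ∀ i, Commute k₁ (q i)) (hkq' : ∀ i, Commute k₁ (q' i))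
    (hkp : ∀ i, Commute k₂ (p i)) (hkp' : ∀ i, Commute k₂ (p' i))
    (hpq : ∀ i j, i ≠ j → Commute (p i) (q j)) (hpq' : ∀ i j, i ≠ j → Commute (p i) (q' j))
    (hp'q : ∀ i j, i ≠ j → Commute (p' i) (q j)) (hp'q' : ∀ i j, i ≠ j → Commute (p' i) (q' j))
    (l : List ι) (hl : l.Nodup) :
    s * ((l.map p).reverse.prod * k₁ * (l.map p').prod) * t *
        ((l.map q).reverse.prod * k₂ * (l.map q').prod) =
      ((l.map q).reverse.prod * k₂ * (l.map q').prod) * t *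
        ((l.map p).reverse.prod * k₁ * (l.map p').prod) * s := by
  induction l using List.reverseRecOn with
  | nil => simpa using hk
  | append_singleton l i ih =>
    have hil : ∀ j ∈ l, j ≠ i := by
      rintro j hj rfl
      simp [List.nodup_append] at hl
      exact (hl.2 _ hj) rfl
    specialize ih (List.Nodup.of_append_left hl)
    have hprod : ∀ (f : ι → M) (m : M), (∀ j, j ≠ i → Commute (f j) m) →
        Commute (l.map f).prod m ∧ Commute (l.map f).reverse.prod m := by
      intro f m hf
      constructor <;> refine Commute.list_prod_left _ _ fun x hx => ?_ <;>
      · simp only [List.mem_reverse, List.mem_map] at hx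
        obtain ⟨j, hj, rfl⟩ := hx
        exact hf j (hil j hj)
    set v₁ := (l.map p).reverse.prod * k₁ * (l.map p').prod with hv₁
    set v₂ := (l.map q).reverse.prod * k₂ * (l.map q').prod with hv₂
    have h1 : v₁ * q i = q i * v₁ := ((((hprod p _ fun j hj => hpq j i hj).2).mul_left
      (hkq i)).mul_left (hprod p' _ fun j hj => hp'q j i hj).1)
    have h2 : v₁ * q' i = q' i * v₁ := ((((hprod p _ fun j hj => hpq' j i hj).2).mul_left
      (hkq' i)).mul_left (hprod p' _ fun j hj => hp'q' j i hj).1)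
    have h3 : v₂ * p i = p i * v₂ := ((((hprod q _ fun j hj => (hpq i j hj.symm).symm).2).mul_left
      (hkp i)).mul_left (hprod q' _ fun j hj => (hpq' i j hj.symm).symm).1)
    have h4 : v₂ * p' i = p' i * v₂ :=
      ((((hprod q _ fun j hj => (hp'q i j hj.symm).symm).2).mul_left
      (hkp' i)).mul_left (hprod q' _ fun j hj => (hp'q' i j hj.symm).symm).1)
    have e₁ : ((l ++ [i]).map p).reverse.prod * k₁ * ((l ++ [i]).map p').prod =
        p i * v₁ * p' i := by simp [hv₁, mul_assoc]
    have e₂ : ((l ++ [i]).map q).reverse.prod * k₂ * ((l ++ [i]).map q').prod =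
        q i * v₂ * q' i := by simp [hv₂, mul_assoc]
    rw [e₁, e₂]
    calc s * (p i * v₁ * p' i) * t * (q i * v₂ * q' i)
        = s * p i * v₁ * (p' i * t * q i) * v₂ * q' i := by simp only [mul_assoc]
      _ = s * p i * (v₁ * q i) * t * (p' i * v₂) * q' i := by rw [hptq]; simp only [mul_assoc]
      _ = (s * p i * q i) * v₁ * t * v₂ * p' i * q' i := by rw [h1, ← h4]; simp only [mul_assoc]
      _ = q i * p i * (s * v₁ * t * v₂) * p' i * q' i := by rw [hspq]; simp only [mul_assoc]
      _ = q i * p i * v₂ * t * v₁ * (s * p' i * q' i) := by rw [ih]; simp only [mul_assoc]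
      _ = q i * (p i * v₂) * t * (v₁ * q' i) * p' i * s := by rw [hspq']; simp only [mul_assoc]
      _ = q i * v₂ * (p i * t * q' i) * v₁ * p' i * s := by rw [h2, ← h3]; simp only [mul_assoc]
      _ = (q i * v₂ * q' i) * t * (p i * v₁ * p' i) * s := by rw [hptq']; simp only [mul_assoc]

section QuantumSpace

variable {L : ℕ}

/-- The algebra of operators on the quantum space `(ℂ²)^{⊗L}`. -/
abbrev QOp (L : ℕ) : Type := Matrix (Fin L → Fin 2) (Fin L → Fin 2) ℂ

/-- The embedding of operators on `ℂ²` as operators on the `j`-th quantum factor. -/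
def siteHom (j : Fin L) : Matrix (Fin 2) (Fin 2) ℂ →+* QOp L :=
  ((Matrix.reindexAlgEquiv ℂ ℂ
    (Equiv.funSplitAt j (Fin 2)).symm).toAlgHom.toRingHom.comp
      (Matrix.blockDiagonalRingHom (Fin 2) ({k // k ≠ j} → Fin 2) ℂ)).comp (Pi.constRingHom _ _)

theorem siteHom_apply (j : Fin L) (X : Matrix (Fin 2) (Fin 2) ℂ) (f g : Fin L → Fin 2) :
    siteHom j X f g = X (f j) (g j) * (if ∀ k, k ≠ j → f k = g k then 1 else 0) := by
  have : siteHom j X f g = if (fun k : {k // k ≠ j} => f k) = (fun k : {k // k ≠ j} => g k)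
      then X (f j) (g j) else 0 := rfl
  rw [this]
  simp [funext_iff]

theorem siteHom_algebraMap (j : Fin L) (z : ℂ) :
    siteHom j (algebraMap ℂ _ z) = algebraMap ℂ _ z := by
  ext f g
  rw [siteHom_apply, algebraMap_matrix_apply, algebraMap_matrix_apply]
  by_cases hfg : f = g
  · simp [hfg]
  · by_cases hj : f j = g j
    · have : ¬ ∀ k, k ≠ j → f k = g k := fun hk =>
        hfg (funext fun k => if hkj : k = j then hkj ▸ hj else hk k hkj)
      simp [hfg, this]
    · simp [hfg, hj]

theorem commute_siteHom {i j : Fin L} (hij : i ≠ j) (X Y : Matrix (Fin 2) (Fin 2) ℂ) :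
    Commute (siteHom i X) (siteHom j Y) := by
  have key : ∀ {i j : Fin L} (hij : i ≠ j) (X Y : Matrix (Fin 2) (Fin 2) ℂ) (f g),
      (siteHom i X * siteHom j Y) f g =
        X (f i) (g i) * Y (f j) (g j) * if ∀ k, k ≠ i → k ≠ j → f k = g k then 1 else 0 := by
    intro i j hij X Y f g
    rw [mul_apply, Finset.sum_eq_single (Function.update f i (g i))]
    · simp only [siteHom_apply, Function.update_self, Function.update_of_ne hij.symm]
      have h1 : ∀ k, k ≠ i → f k = Function.update f i (g i) k := fun k hk => by simp [hk]
      have h2 : (∀ k, k ≠ j → Function.update f i (g i) k = g k) ↔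
          ∀ k, k ≠ i → k ≠ j → f k = g k := by
        refine ⟨fun hk k hi hj => by simpa [hi] using hk k hj, fun hk k hj => ?_⟩
        by_cases hi : k = i
        · subst hi; simp
        · simpa [hi] using hk k hi hj
      rw [if_pos h1]
      simp only [h2, mul_one, mul_assoc]
    · intro e _ he
      rw [siteHom_apply, siteHom_apply]
      by_cases h1 : ∀ k, k ≠ i → f k = e k
      · have h2 : ¬ ∀ k, k ≠ j → e k = g k := fun h2 => he <| funext fun k => by
          by_cases hk : k = i
          · subst hk; simpa using h2 k hij
          · simpa [hk] using (h1 k hk).symm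
        simp [h2]
      · simp [h1]
    · simp
  change _ = _
  ext f g
  rw [key hij, key hij.symm, mul_comm (X _ _)]
  congr 2
  simp only [eq_iff_iff]
  exact ⟨fun h k a b => h k b a, fun h k a b => h k b a⟩

/-- An operator on `ℂ² ⊗ (ℂ²)^{⊗L}` as a `2 × 2` matrix of operators on the quantum space. -/
def blocks : Matrix (Fin 2 × (Fin L → Fin 2)) (Fin 2 × (Fin L → Fin 2)) ℂ ≃+*
    Matrix (Fin 2) (Fin 2) (QOp L) :=
  (Matrix.compRingEquiv (Fin 2) (Fin L → Fin 2) ℂ).symm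

theorem blocks_apply (X : Matrix (Fin 2 × (Fin L → Fin 2)) (Fin 2 × (Fin L → Fin 2)) ℂ)
    (i j : Fin 2) (f g : Fin L → Fin 2) : blocks X i j f g = X (i, f) (j, g) := rfl

theorem blocks_Raux (γ u : ℂ) (j : Fin L) :
    blocks (Raux γ u j) = (siteHom j).mapMatrix (lax γ u) := by
  ext α β f g
  rw [blocks_apply, RingHom.mapMatrix_apply, map_apply, siteHom_apply]
  rfl

/-- The undressed double-row monodromy matrix, without the factor `K̄`. -/
def doubleRow (γ h : ℂ) (μ : Fin L → ℂ) (x : ℂ) : Matrix (Fin 2) (Fin 2) (QOp L) :=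
  ((List.finRange L).map fun j => (siteHom j).mapMatrix (lax γ (x - μ j))).reverse.prod *
    (algebraMap ℂ (QOp L)).mapMatrix (Kd h x) *
    ((List.finRange L).map fun j => (siteHom j).mapMatrix (lax γ (x + μ j))).prod

theorem blocks_Topen (γ h hb : ℂ) (μ : Fin L → ℂ) (x : ℂ) :
    blocks (Topen γ h hb μ x) =
      (algebraMap ℂ (QOp L)).mapMatrix (Kbar γ hb x) * doubleRow γ h μ x := by
  have hK : blocks (K0lift h x) = (algebraMap ℂ (QOp L)).mapMatrix (Kd h x) := by
    ext α β f g
    simp [blocks_apply, K0lift, algebraMap_matrix_apply]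
  have hKbar : blocks (Kbar0lift γ hb x) = (algebraMap ℂ (QOp L)).mapMatrix (Kbar γ hb x) := by
    ext α β f g
    simp [blocks_apply, Kbar0lift, algebraMap_matrix_apply]
  simp only [Topen, doubleRow, map_mul, hK, hKbar, map_list_prod, List.map_reverse,
    List.ofFn_eq_map, List.map_map, mul_assoc]
  congr! 4
  · exact List.map_congr_left fun j _ => blocks_Raux ..
  · exact List.map_congr_left fun j _ => blocks_Raux ..

theorem BmatO_eq (γ h hb : ℂ) (μ : Fin L → ℂ) (x : ℂ) :
    BmatO γ h hb μ x = Complex.sinh (hb - x - γ) • doubleRow γ h μ x 0 1 := by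
  have : BmatO γ h hb μ x = blocks (Topen γ h hb μ x) 0 1 := rfl
  rw [this, blocks_Topen, mul_apply]
  simp [Kbar, Algebra.smul_def]

theorem CmatO_eq (γ h hb : ℂ) (μ : Fin L → ℂ) (x : ℂ) :
    CmatO γ h hb μ x = Complex.sinh (hb + x + γ) • doubleRow γ h μ x 1 0 := by
  have : CmatO γ h hb μ x = blocks (Topen γ h hb μ x) 1 0 := rfl
  rw [this, blocks_Topen, mul_apply]
  simp [Kbar, Algebra.smul_def]

theorem auxR_eq_siteHom (γ u : ℂ) (j : Fin L) :
    auxR (QOp L) γ u = (siteHom j).mapMatrix (auxR (Matrix (Fin 2) (Fin 2) ℂ) γ u) := by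
  ext1 p q
  simp only [auxR, RingHom.mapMatrix_apply, map_apply, siteHom_algebraMap]

theorem auxR_mul_siteLax_mul_siteLax (γ : ℂ) (j : Fin L) {u v w : ℂ} (hw : w = u + v) :
    auxR (QOp L) γ u * auxLeft ((siteHom j).mapMatrix (lax γ w)) *
        auxRight ((siteHom j).mapMatrix (lax γ v)) =
      auxRight ((siteHom j).mapMatrix (lax γ v)) * auxLeft ((siteHom j).mapMatrix (lax γ w)) *
        auxR (QOp L) γ u := by
  rw [auxR_eq_siteHom γ _ j, auxLeft_mapMatrix, auxRight_mapMatrix, ← map_mul, ← map_mul,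
    auxR_mul_lax_mul_lax γ hw, map_mul, map_mul]

theorem siteLax_mul_auxR_mul_siteLax (γ : ℂ) (j : Fin L) {u v w : ℂ} (hw : w = u + v) :
    auxLeft ((siteHom j).mapMatrix (lax γ u)) * auxR (QOp L) γ w *
        auxRight ((siteHom j).mapMatrix (lax γ v)) =
      auxRight ((siteHom j).mapMatrix (lax γ v)) * auxR (QOp L) γ w *
        auxLeft ((siteHom j).mapMatrix (lax γ u)) := by
  rw [auxR_eq_siteHom γ _ j, auxLeft_mapMatrix, auxRight_mapMatrix, ← map_mul, ← map_mul,
    lax_mul_auxR_mul_lax γ hw, map_mul, map_mul]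

theorem commute_siteHom_mapMatrix {i j : Fin L} (hij : i ≠ j)
    (X Y : Matrix (Fin 2) (Fin 2) (Matrix (Fin 2) (Fin 2) ℂ)) :
    Commute (auxLeft ((siteHom i).mapMatrix X)) (auxRight ((siteHom j).mapMatrix Y)) := by
  refine commute_auxLeft_auxRight fun a b c d => ?_
  simp only [RingHom.mapMatrix_apply, map_apply]
  exact commute_siteHom hij _ _

/-- The reflection equation for the double-row monodromy matrix. -/
theorem reflection_equation (γ h : ℂ) (μ : Fin L → ℂ) (x y : ℂ) :
    auxR (QOp L) γ (x - y) * auxLeft (doubleRow γ h μ x) * auxR (QOp L) γ (x + y) *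
        auxRight (doubleRow γ h μ y) =
      auxRight (doubleRow γ h μ y) * auxR (QOp L) γ (x + y) * auxLeft (doubleRow γ h μ x) *
        auxR (QOp L) γ (x - y) := by
  simp only [doubleRow, map_mul, map_list_prod, List.map_reverse, List.map_map]
  apply reflection_equation_dressed (l := List.finRange L)
  · rw [auxR, auxR, auxLeft_mapMatrix, auxRight_mapMatrix, ← map_mul, ← map_mul, ← map_mul,
      reflection_equation_Kd, map_mul, map_mul, map_mul]
  · exact fun j => auxR_mul_siteLax_mul_siteLax γ j (by ring)
  · exact fun j => auxR_mul_siteLax_mul_siteLax γ j (by ring)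
  · exact fun j => siteLax_mul_auxR_mul_siteLax γ j (by ring)
  · exact fun j => siteLax_mul_auxR_mul_siteLax γ j (by ring)
  · exact fun j => commute_auxLeft_algebraMap _ _
  · exact fun j => commute_auxLeft_algebraMap _ _
  · exact fun j => commute_auxRight_algebraMap _ _
  · exact fun j => commute_auxRight_algebraMap _ _
  · exact fun i j hij => commute_siteHom_mapMatrix hij _ _
  · exact fun i j hij => commute_siteHom_mapMatrix hij _ _
  · exact fun i j hij => commute_siteHom_mapMatrix hij _ _
  · exact fun i j hij => commute_siteHom_mapMatrix hij _ _
  · exact List.nodup_finRange L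

theorem smul_commutator_eq_zero (γ h : ℂ) (μ : Fin L → ℂ) (x y : ℂ) {i j : Fin 2} (hij : i ≠ j) :
    (Complex.sinh (x - y + γ) * Complex.sinh (x + y)) •
      (doubleRow γ h μ x i j * doubleRow γ h μ y i j -
        doubleRow γ h μ y i j * doubleRow γ h μ x i j) = 0 := by
  have hRE := congrFun (congrFun (reflection_equation γ h μ x y) (i, i)) (j, j)
  rw [smul_sub, sub_eq_zero]
  fin_cases i <;> fin_cases j <;> first | exact absurd rfl hij | skip
  all_goals
    simp [mul_apply, Fintype.sum_prod_type, auxLeft_apply, auxRight_apply, auxR, Rmat, af, bf,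
      ← Algebra.smul_def, ← Algebra.commutes, mul_assoc, smul_smul] at hRE
    exact hRE

theorem continuous_doubleRow_apply (γ h : ℂ) (μ : Fin L → ℂ) (i j : Fin 2) :
    Continuous fun x => doubleRow γ h μ x i j := by
  have hlax : ∀ (k : Fin L) (c : ℂ),
      Continuous fun x => (siteHom k).mapMatrix (lax γ (x + c)) := fun k c => by
    refine continuous_matrix fun α β => continuous_matrix fun f g => ?_
    simp only [RingHom.mapMatrix_apply, map_apply, siteHom_apply, lax, Rmat, af, bf, cf]
    refine Continuous.mul ?_ continuous_const
    split_ifs <;> fun_prop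
  have hK : Continuous fun x => (algebraMap ℂ (QOp L)).mapMatrix (Kd h x) := by
    refine continuous_matrix fun α β => continuous_matrix fun f g => ?_
    simp only [RingHom.mapMatrix_apply, map_apply, algebraMap_matrix_apply, Kd]
    fin_cases α <;> fin_cases β <;> split_ifs <;> first | exact continuous_const | (simp; fun_prop)
  have : Continuous fun x => doubleRow γ h μ x := by
    simp only [doubleRow, ← List.map_reverse, sub_eq_add_neg]
    exact ((continuous_list_prod _ fun k _ => hlax k _).mul hK).mul
      (continuous_list_prod _ fun k _ => hlax k _)
  exact this.matrix_elem i j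

theorem eventually_sinh_ne_zero (z : ℂ) : ∀ᶠ x in nhdsWithin z {z}ᶜ, Complex.sinh x ≠ 0 := by
  by_cases hz : Complex.sinh z = 0
  · refine (Complex.hasDerivAt_sinh z).eventually_ne fun hc => ?_
    simpa [hz, hc] using Complex.cosh_sq z
  · exact (Complex.continuous_sinh.continuousAt.eventually_ne hz).filter_mono nhdsWithin_le_nhds

theorem commute_doubleRow (γ h : ℂ) (μ : Fin L → ℂ) (x y : ℂ) {i j : Fin 2} (hij : i ≠ j) :
    Commute (doubleRow γ h μ x i j) (doubleRow γ h μ y i j) := by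
  have hc : Continuous fun x' => doubleRow γ h μ x' i j * doubleRow γ h μ y i j -
      doubleRow γ h μ y i j * doubleRow γ h μ x' i j := by
    have := continuous_doubleRow_apply γ h μ i j
    fun_prop
  have hshift : ∀ c : ℂ, ∀ᶠ x' in nhdsWithin x {x}ᶜ, Complex.sinh (x' + c) ≠ 0 := fun c => by
    have ht : Filter.Tendsto (fun x' => x' + c) (nhdsWithin x {x}ᶜ)
        (nhdsWithin (x + c) {x + c}ᶜ) :=
      tendsto_nhdsWithin_of_tendsto_nhds_of_eventually_within _
        ((continuous_id.add continuous_const).continuousAt.tendsto.mono_left nhdsWithin_le_nhds)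
        (eventually_mem_nhdsWithin.mono fun x' hx' => by simpa using hx')
    exact ht.eventually (eventually_sinh_ne_zero _)
  have h0 : ∀ᶠ x' in nhdsWithin x {x}ᶜ, (0 : QOp L) =
      doubleRow γ h μ x' i j * doubleRow γ h μ y i j -
        doubleRow γ h μ y i j * doubleRow γ h μ x' i j := by
    filter_upwards [hshift (-y + γ), hshift y] with x' h1 h2
    have := smul_commutator_eq_zero γ h μ x' y hij
    rw [sub_eq_add_neg x' y, add_assoc] at this
    exact ((smul_eq_zero.mp this).resolve_left (mul_ne_zero h1 h2)).symm
  have hlim := (hc.continuousAt (x := x)).tendsto.mono_left (nhdsWithin_le_nhds (s := {x}ᶜ))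
  exact sub_eq_zero.mp (tendsto_nhds_unique hlim (tendsto_const_nhds.congr' h0))

end QuantumSpace

theorem prod_ofFn_comp_perm {M : Type*} [Monoid M] {α : Type*} {n : ℕ} (F : α → M)
    (hF : ∀ a b, Commute (F a) (F b)) (x : Fin n → α) (σ : Equiv.Perm (Fin n)) :
    (List.ofFn fun i => F ((x ∘ σ) i)).prod = (List.ofFn fun i => F (x i)).prod := by
  refine (Equiv.Perm.ofFn_comp_perm σ fun i => F (x i)).prod_eq' ?_
  exact List.pairwise_of_forall_mem_list fun a ha b hb => by
    obtain ⟨i, rfl⟩ := (List.mem_ofFn' _ _).mp ha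
    obtain ⟨j, rfl⟩ := (List.mem_ofFn' _ _).mp hb
    exact hF _ _

end OpenSixVertex

open OpenSixVertex in
/-- The off-shell scalar product of the open six-vertex chain is a symmetric
function of each group of its variables. -/
theorem SoffO_symmetric (γ h hb : ℂ) (L n : ℕ) (hL : 0 < L) (hn : n ≤ L)
    (μ : Fin L → ℂ) (x y : Fin n → ℂ) (σ τ : Equiv.Perm (Fin n)) :
    SoffO γ h hb μ (x ∘ σ) (y ∘ τ) = SoffO γ h hb μ x y := by
  have hC : ∀ a b, Commute (CmatO γ h hb μ a) (CmatO γ h hb μ b) := fun a b => by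
    rw [CmatO_eq, CmatO_eq]
    exact ((commute_doubleRow γ h μ a b (by decide)).smul_left _).smul_right _
  have hB : ∀ a b, Commute (BmatO γ h hb μ a) (BmatO γ h hb μ b) := fun a b => by
    rw [BmatO_eq, BmatO_eq]
    exact ((commute_doubleRow γ h μ a b (by decide)).smul_left _).smul_right _
  rw [SoffO, SoffO, prod_ofFn_comp_perm _ hC, prod_ofFn_comp_perm _ hB]
end
end
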